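/- Let R > 0, let M ≥ 2 and k ≥ 1 be integers, let a : ℂ → [0,∞) be a smooth function, and let μ̂ := (a·σ) restricted to Q_R, with μ̂(Q_R) = (M−1)/M. Set L := k(M−1). Then there exist closed rectangles Q^{(1)}, …, Q^{(L)} contained in the closure of Q_R, each with sides parallel to the coordinate axes and with ratio of longest to shortest side at most 3, whose union contains Q_R and such that every point of ℂ belongs to at most four of the rectangles, together with positive Borel measures μ^{(1)}, …, μ^{(L)} with μ̂ = Σ_{l=1}^{L} μ^{(l)}, supp μ^{(l)} ⊆ Q^{(l)} for each l, and μ^{(l)}(Q^{(l)}) = 1/(kM) for each l. -/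

import Mathlib

open MeasureTheory Filter Topology

noncomputable section

/-- The open square `Q_R = {x + iy : |x| < R, |y| < R}`. -/
def QR (R : ℝ) : Set ℂ := {z : ℂ | |z.re| < R ∧ |z.im| < R}


open Function Set in
/-- Coordinates of a complex number. -/
def co (z : ℂ) : Bool → ℝ := fun i => if i then z.im else z.re

def bx (lo hi : Bool → ℝ) : Set ℂ := co ⁻¹' Set.Icc lo hi

open Classical in
def mult {ι : Type} [Fintype ι] (ql qh : ι → Bool → ℝ) (f : Bool → ℝ) : ℕ :=
  ∑ l, if f ∈ Set.Icc (ql l) (qh l) then 1 else 0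

def ZL (μ : Measure ℂ) (κ : ℝ) (N : ℕ) (lo hi : Bool → ℝ) (i : Bool) (f : Bool → ℝ) : Prop :=
  ∃ δ : ℝ, 0 ≤ δ ∧ (μ.real (bx lo (Function.update hi i (lo i + δ))) < κ ∨ N = 1) ∧
    f i ≤ lo i + 2 * δ / 3

def ZH (μ : Measure ℂ) (κ : ℝ) (N : ℕ) (lo hi : Bool → ℝ) (i : Bool) (f : Bool → ℝ) : Prop :=
  ∃ δ : ℝ, 0 ≤ δ ∧ (μ.real (bx (Function.update lo i (hi i - δ)) hi) < κ ∨ N = 1) ∧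
    hi i - 2 * δ / 3 ≤ f i

def ZZ (μ : Measure ℂ) (κ : ℝ) (N : ℕ) (lo hi : Bool → ℝ) (i : Bool) (f : Bool → ℝ) : Prop :=
  ZL μ κ N lo hi i f ∨ ZH μ κ N lo hi i f

structure GoodFam (μ : Measure ℂ) (κ : ℝ) (N : ℕ) (lo hi elo ehi : Bool → ℝ)
    (ι : Type) [Fintype ι] (ql qh : ι → Bool → ℝ) (ν : ι → Measure ℂ) : Prop where
  card : Fintype.card ι = N
  envl : ∀ l i, elo i ≤ ql l i
  envh : ∀ l i, qh l i ≤ ehi i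
  le : ∀ l i, ql l i ≤ qh l i
  ratio : ∀ l i, qh l i - ql l i ≤ 3 * (qh l (!i) - ql l (!i))
  meetl : ∀ l i, ql l i ≤ hi i
  meeth : ∀ l i, lo i ≤ qh l i
  cover : ∀ f ∈ Set.Icc lo hi, ∃ l, f ∈ Set.Icc (ql l) (qh l)
  sum : ∑ l, ν l = μ.restrict (bx lo hi)
  supp : ∀ l, ν l (bx (ql l) (qh l))ᶜ = 0
  mass : ∀ l, ν l Set.univ = ENNReal.ofReal κ
  m4 : ∀ f ∈ Set.Icc lo hi, mult ql qh f ≤ 4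
  m2 : ∀ f ∈ Set.Icc lo hi, ∀ i, ZZ μ κ N lo hi i f → mult ql qh f ≤ 2
  m1 : ∀ f ∈ Set.Icc lo hi, ∀ i, ZZ μ κ N lo hi i f → ZZ μ κ N lo hi (!i) f → mult ql qh f ≤ 1

def Good (μ : Measure ℂ) (κ : ℝ) (N : ℕ) (lo hi elo ehi : Bool → ℝ) : Prop :=
  ∃ (ι : Type) (_ : Fintype ι) (ql qh : ι → Bool → ℝ) (ν : ι → Measure ℂ),
    GoodFam μ κ N lo hi elo ehi ι ql qh ν

theorem measurable_co : Measurable co := by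
  refine measurable_pi_lambda _ fun i => ?_
  cases i
  · simpa [co] using Complex.measurable_re
  · simpa [co] using Complex.measurable_im

theorem measurableSet_bx (lo hi : Bool → ℝ) : MeasurableSet (bx lo hi) :=
  measurable_co measurableSet_Icc

theorem bx_mono {lo hi lo' hi' : Bool → ℝ} (h1 : ∀ i, lo' i ≤ lo i) (h2 : ∀ i, hi i ≤ hi' i) :
    bx lo hi ⊆ bx lo' hi' :=
  Set.preimage_mono (Set.Icc_subset_Icc h1 h2)

theorem mult_le_card {ι : Type} [Fintype ι] (ql qh : ι → Bool → ℝ) (f : Bool → ℝ) :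
    mult ql qh f ≤ Fintype.card ι := by
  classical
  unfold mult
  refine (Finset.sum_le_card_nsmul _ _ 1 ?_).trans (by simp)
  intro l _
  split_ifs <;> simp

theorem mult_sum {ι ι' : Type} [Fintype ι] [Fintype ι'] (ql qh : ι → Bool → ℝ)
    (ql' qh' : ι' → Bool → ℝ) (f : Bool → ℝ) :
    mult (Sum.elim ql ql') (Sum.elim qh qh') f = mult ql qh f + mult ql' qh' f := by
  classical
  unfold mult
  rw [Fintype.sum_sum_type]
  rfl

theorem mult_mono {ι : Type} [Fintype ι] {ql qh : ι → Bool → ℝ} {f g : Bool → ℝ}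
    (h : ∀ l, f ∈ Set.Icc (ql l) (qh l) → g ∈ Set.Icc (ql l) (qh l)) :
    mult ql qh f ≤ mult ql qh g := by
  classical
  unfold mult
  refine Finset.sum_le_sum fun l _ => ?_
  by_cases hf : f ∈ Set.Icc (ql l) (qh l)
  · simp [hf, h l hf]
  · simp [hf]

theorem mult_zero {ι : Type} [Fintype ι] {ql qh : ι → Bool → ℝ} {f : Bool → ℝ}
    (h : ∀ l, f ∉ Set.Icc (ql l) (qh l)) : mult ql qh f = 0 := by
  classical
  unfold mult
  exact Finset.sum_eq_zero fun l _ => by simp [h l]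

theorem bx_split (μ : Measure ℂ) (hnull : ∀ i t, μ {z | co z i = t} = 0) (lo hi : Bool → ℝ)
    (i : Bool) (c : ℝ) (h1 : lo i ≤ c) (h2 : c ≤ hi i) :
    μ.restrict (bx lo hi) = μ.restrict (bx lo (Function.update hi i c)) +
      μ.restrict (bx (Function.update lo i c) hi) := by
  have hu : bx lo hi = bx lo (Function.update hi i c) ∪ bx (Function.update lo i c) hi := by
    ext z
    simp only [bx, Set.mem_preimage, Set.mem_Icc, Set.mem_union, Pi.le_def]
    constructor
    · rintro ⟨ha, hb⟩
      rcases le_total (co z i) c with h | h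
      · left
        refine ⟨ha, fun j => ?_⟩
        by_cases hj : j = i
        · subst hj; simpa using h
        · simpa [hj] using hb j
      · right
        refine ⟨fun j => ?_, hb⟩
        by_cases hj : j = i
        · subst hj; simpa using h
        · simpa [hj] using ha j
    · rintro (⟨ha, hb⟩ | ⟨ha, hb⟩)
      · refine ⟨ha, fun j => (hb j).trans ?_⟩
        by_cases hj : j = i
        · subst hj; simpa using h2
        · simp [hj]
      · refine ⟨fun j => le_trans ?_ (ha j), hb⟩
        by_cases hj : j = i
        · subst hj; simpa using h1
        · simp [hj]
  rw [hu]
  refine Measure.restrict_union₀ ?_ (measurableSet_bx _ _).nullMeasurableSet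
  refine measure_mono_null ?_ (hnull i c)
  rintro z ⟨⟨_, hb⟩, ⟨ha, _⟩⟩
  have e1 := hb i
  have e2 := ha i
  simp only [Function.update_self] at e1 e2
  exact le_antisymm e1 e2

theorem cont_mass (μ : Measure ℂ) [IsFiniteMeasure μ]
    (hnull : ∀ i t, μ {z | co z i = t} = 0) (lo hi : Bool → ℝ) (i : Bool) :
    Continuous fun c => μ.real (bx lo (Function.update hi i c)) := by
  have e : (fun c => μ.real (bx lo (Function.update hi i c))) =
      fun c => ∫ z, (bx lo (Function.update hi i c)).indicator (fun _ => (1 : ℝ)) z ∂μ := by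
    funext c
    rw [integral_indicator (measurableSet_bx _ _)]
    simp
  rw [e, continuous_iff_continuousAt]
  intro c0
  refine continuousAt_of_dominated (bound := fun _ => 1) ?_ ?_ (integrable_const _) ?_
  · exact Eventually.of_forall fun c =>
      (measurable_const.indicator (measurableSet_bx _ _)).aestronglyMeasurable
  · refine Eventually.of_forall fun c => Eventually.of_forall fun z => ?_
    by_cases hz : z ∈ bx lo (Function.update hi i c) <;> simp [hz]
  · have : ∀ᵐ z ∂μ, co z i ≠ c0 := by
      rw [ae_iff]; simpa using hnull i c0
    filter_upwards [this] with z hz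
    have key : ∀ᶠ c in 𝓝 c0, (z ∈ bx lo (Function.update hi i c) ↔
        z ∈ bx lo (Function.update hi i c0)) := by
      have : ∀ᶠ c in 𝓝 c0, (co z i ≤ c ↔ co z i ≤ c0) := by
        rcases lt_or_gt_of_ne hz with h | h
        · filter_upwards [lt_mem_nhds h] with c hc
          exact ⟨fun _ => h.le, fun _ => hc.le⟩
        · filter_upwards [gt_mem_nhds h] with c hc
          exact ⟨fun h' => absurd h' (not_le.2 hc), fun h' => absurd h' (not_le.2 h)⟩
      filter_upwards [this] with c hc
      simp only [bx, Set.mem_preimage, Set.mem_Icc, le_update_iff, hc]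
    refine ContinuousAt.congr (f := fun _ =>
      (bx lo (Function.update hi i c0)).indicator (fun _ => (1 : ℝ)) z) continuousAt_const ?_
    filter_upwards [key] with c hc
    by_cases h : z ∈ bx lo (Function.update hi i c0)
    · simp [h, hc.2 h]
    · have : z ∉ bx lo (Function.update hi i c) := fun h' => h (hc.1 h')
      simp [h, this]

theorem mid_interval {a b A B ℓ : ℝ} (h1 : A ≤ a) (h2 : b ≤ B) (h3 : b - a ≤ ℓ)
    (h4 : ℓ ≤ B - A) : ∃ a' b', A ≤ a' ∧ a' ≤ a ∧ b ≤ b' ∧ b' ≤ B ∧ b' - a' = ℓ := by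
  refine ⟨max A (b - ℓ), max A (b - ℓ) + ℓ, le_max_left _ _, max_le h1 (by linarith), ?_, ?_, by ring⟩
  · linarith [le_max_right A (b - ℓ)]
  · rcases max_cases A (b - ℓ) with ⟨h, _⟩ | ⟨h, _⟩ <;> rw [h] <;> linarith

theorem good_one (μ : Measure ℂ) [IsFiniteMeasure μ] (κ : ℝ) (lo hi elo ehi : Bool → ℝ)
    (hlh : ∀ i, lo i < hi i) (hel : ∀ i, elo i ≤ lo i) (heh : ∀ i, hi i ≤ ehi i)
    (hr : ∀ i, ehi i - elo i ≤ 3 * (ehi (!i) - elo (!i)))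
    (hm : μ.real (bx lo hi) = κ) : Good μ κ 1 lo hi elo ehi := by
  have hmul : ∀ f, mult (fun _ : Unit => elo) (fun _ => ehi) f ≤ 1 := fun f => by
    simpa using mult_le_card (fun _ : Unit => elo) (fun _ => ehi) f
  refine ⟨Unit, inferInstance, fun _ => elo, fun _ => ehi, fun _ => μ.restrict (bx lo hi), ?_⟩
  exact
  { card := by simp
    envl := fun _ _ => le_rfl
    envh := fun _ _ => le_rfl
    le := fun _ i => ((hel i).trans (hlh i).le).trans (heh i)
    ratio := fun _ => hr
    meetl := fun _ i => (hel i).trans (hlh i).le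
    meeth := fun _ i => (hlh i).le.trans (heh i)
    cover := fun f hf => ⟨(), Set.Icc_subset_Icc hel heh hf⟩
    sum := by simp
    supp := fun _ => by
      rw [Measure.restrict_apply (measurableSet_bx _ _).compl]
      have : (bx elo ehi)ᶜ ∩ bx lo hi = ∅ := by
        rw [← Set.disjoint_iff_inter_eq_empty]
        exact (Set.disjoint_compl_left_iff_subset).2 (bx_mono hel heh)
      simp [this]
    mass := fun _ => by
      rw [Measure.restrict_apply_univ, ← hm, Measure.real, ENNReal.ofReal_toReal (measure_ne_top _ _)]
    m4 := fun f _ => (hmul f).trans (by norm_num)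
    m2 := fun f _ _ _ => (hmul f).trans (by norm_num)
    m1 := fun f _ _ _ _ => hmul f }

/-- Transport of a low zone on the transversal axis. -/
theorem ZZ_trans (μ : Measure ℂ) [IsFiniteMeasure μ] (κ : ℝ) (N N' : ℕ) (hN : N ≠ 1)
    (lo hi lo' hi' : Bool → ℝ) (i : Bool) (f f' : Bool → ℝ)
    (h1 : ∀ j, lo j ≤ lo' j) (h2 : ∀ j, hi' j ≤ hi j) (e1 : lo' i = lo i) (e2 : hi' i = hi i)
    (ef : f' i = f i) (h : ZZ μ κ N lo hi i f) : ZZ μ κ N' lo' hi' i f' := by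
  rcases h with ⟨δ, hδ, hm, hz⟩ | ⟨δ, hδ, hm, hz⟩
  · left
    refine ⟨δ, hδ, Or.inl ?_, by rw [ef, e1]; exact hz⟩
    refine lt_of_le_of_lt ?_ (hm.resolve_right hN)
    refine measureReal_mono (bx_mono h1 fun j => ?_)
    by_cases hj : j = i
    · subst hj; simp [e1]
    · simpa [hj] using h2 j
  · right
    refine ⟨δ, hδ, Or.inl ?_, by rw [ef, e2]; exact hz⟩
    refine lt_of_le_of_lt ?_ (hm.resolve_right hN)
    refine measureReal_mono (bx_mono (fun j => ?_) h2)
    by_cases hj : j = i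
    · subst hj; simp [e2]
    · simpa [hj] using h1 j

theorem combine (μ : Measure ℂ) [IsFiniteMeasure μ] (κ : ℝ) (hκ : 0 < κ)
    (hnull : ∀ i t, μ {z | co z i = t} = 0) (N₁ N₂ : ℕ) (hN₁ : 1 ≤ N₁) (hN₂ : 1 ≤ N₂)
    (lo hi elo ehi e₁lo e₁hi e₂lo e₂hi : Bool → ℝ) (i : Bool) (c u v : ℝ)
    (hlc : lo i ≤ c) (hch : c ≤ hi i)
    (hvc : v ≤ c) (hcu : c ≤ u)
    (hE1l : ∀ j, elo j ≤ e₁lo j) (hE1h : ∀ j, e₁hi j ≤ ehi j)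
    (hE2l : ∀ j, elo j ≤ e₂lo j) (hE2h : ∀ j, e₂hi j ≤ ehi j)
    (hu : e₁hi i ≤ u) (hv : v ≤ e₂lo i)
    (hv' : lo i + 2 * (c - lo i) / 3 ≤ v) (hu' : u ≤ hi i - 2 * (hi i - c) / 3)
    (hm₁ : μ.real (bx lo (Function.update hi i c)) = N₁ * κ)
    (hm₂ : μ.real (bx (Function.update lo i c) hi) = N₂ * κ)
    (hz₁ : ∀ x, v ≤ x → x ≤ c →
      ∀ f : Bool → ℝ, f i = x → ZZ μ κ N₁ lo (Function.update hi i c) i f)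
    (hz₂ : ∀ x, c ≤ x → x ≤ u →
      ∀ f : Bool → ℝ, f i = x → ZZ μ κ N₂ (Function.update lo i c) hi i f)
    (G₁ : Good μ κ N₁ lo (Function.update hi i c) e₁lo e₁hi)
    (G₂ : Good μ κ N₂ (Function.update lo i c) hi e₂lo e₂hi) :
    Good μ κ (N₁ + N₂) lo hi elo ehi := by
  obtain ⟨ι₁, _, ql₁, qh₁, ν₁, G₁⟩ := G₁
  obtain ⟨ι₂, _, ql₂, qh₂, ν₂, G₂⟩ := G₂
  have hN : N₁ + N₂ ≠ 1 := by omega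
  have upl : ∀ j, lo j ≤ Function.update lo i c j := fun j => by
    by_cases hj : j = i
    · subst hj; simpa using hlc
    · simp [hj]
  have uph : ∀ j, Function.update hi i c j ≤ hi j := fun j => by
    by_cases hj : j = i
    · subst hj; simpa using hch
    · simp [hj]
  have hni : (!i) ≠ i := by cases i <;> simp
  -- low zones along the cut axis
  have zoneL : ∀ f, ZL μ κ (N₁ + N₂) lo hi i f →
      f i < v ∧ ZL μ κ N₁ lo (Function.update hi i c) i f := by
    rintro f ⟨δ, hδ, hm, hz⟩
    have hm := hm.resolve_right hN
    have hc : lo i + δ < c := by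
      by_contra hcon
      have : μ.real (bx lo (Function.update hi i c)) ≤
          μ.real (bx lo (Function.update hi i (lo i + δ))) := by
        refine measureReal_mono (bx_mono (fun _ => le_rfl) fun j => ?_)
        by_cases hj : j = i
        · subst hj; simpa using not_lt.1 hcon
        · simp [hj]
      rw [hm₁] at this
      have : (1 : ℝ) ≤ N₁ := by exact_mod_cast hN₁
      nlinarith
    refine ⟨by linarith, δ, hδ, Or.inl ?_, hz⟩
    simpa using hm
  have zoneH : ∀ f, ZH μ κ (N₁ + N₂) lo hi i f →
      u < f i ∧ ZH μ κ N₂ (Function.update lo i c) hi i f := by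
    rintro f ⟨δ, hδ, hm, hz⟩
    have hm := hm.resolve_right hN
    have hc : c < hi i - δ := by
      by_contra hcon
      have : μ.real (bx (Function.update lo i c) hi) ≤
          μ.real (bx (Function.update lo i (hi i - δ)) hi) := by
        refine measureReal_mono (bx_mono (fun j => ?_) fun _ => le_rfl)
        by_cases hj : j = i
        · subst hj; simpa using not_lt.1 hcon
        · simp [hj]
      rw [hm₂] at this
      have : (1 : ℝ) ≤ N₂ := by exact_mod_cast hN₂
      nlinarith
    refine ⟨by linarith, δ, hδ, Or.inl ?_, hz⟩
    simpa using hm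
  -- projections
  have proj₁ : ∀ f, mult ql₁ qh₁ f ≤ mult ql₁ qh₁ (Function.update f i (min (f i) c)) := by
    intro f
    refine mult_mono fun l hl => ⟨fun j => ?_, fun j => ?_⟩
    · by_cases hj : j = i
      · subst hj
        have := G₁.meetl l j
        simp only [Function.update_self] at this ⊢
        exact le_min (hl.1 j) this
      · simpa [hj] using hl.1 j
    · by_cases hj : j = i
      · subst hj
        simp only [Function.update_self]
        exact (min_le_left _ _).trans (hl.2 j)
      · simpa [hj] using hl.2 j
  have proj₂ : ∀ f, mult ql₂ qh₂ f ≤ mult ql₂ qh₂ (Function.update f i (max (f i) c)) := by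
    intro f
    refine mult_mono fun l hl => ⟨fun j => ?_, fun j => ?_⟩
    · by_cases hj : j = i
      · subst hj
        simp only [Function.update_self]
        exact (hl.1 j).trans (le_max_left _ _)
      · simpa [hj] using hl.1 j
    · by_cases hj : j = i
      · subst hj
        have := G₂.meeth l j
        simp only [Function.update_self] at this ⊢
        exact max_le (hl.2 j) this
      · simpa [hj] using hl.2 j
  have pm₁ : ∀ f ∈ Set.Icc lo hi,
      Function.update f i (min (f i) c) ∈ Set.Icc lo (Function.update hi i c) := by
    intro f hf
    refine ⟨fun j => ?_, fun j => ?_⟩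
    · by_cases hj : j = i
      · subst hj
        simpa using ⟨hf.1 j, hlc⟩
      · simpa [hj] using hf.1 j
    · by_cases hj : j = i
      · subst hj
        simp
      · simpa [hj] using hf.2 j
  have pm₂ : ∀ f ∈ Set.Icc lo hi,
      Function.update f i (max (f i) c) ∈ Set.Icc (Function.update lo i c) hi := by
    intro f hf
    refine ⟨fun j => ?_, fun j => ?_⟩
    · by_cases hj : j = i
      · subst hj
        simp
      · simpa [hj] using hf.1 j
    · by_cases hj : j = i
      · subst hj
        simpa using ⟨hf.2 j, hch⟩
      · simpa [hj] using hf.2 j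
  have tr₁ : ∀ f g, g (!i) = f (!i) → ZZ μ κ (N₁ + N₂) lo hi (!i) f →
      ZZ μ κ N₁ lo (Function.update hi i c) (!i) g := fun f g hg h =>
    ZZ_trans μ κ _ N₁ hN lo hi _ _ (!i) f g (fun _ => le_rfl) uph rfl (by simp [hni]) hg h
  have tr₂ : ∀ f g, g (!i) = f (!i) → ZZ μ κ (N₁ + N₂) lo hi (!i) f →
      ZZ μ κ N₂ (Function.update lo i c) hi (!i) g := fun f g hg h =>
    ZZ_trans μ κ _ N₂ hN lo hi _ _ (!i) f g upl (fun _ => le_rfl) (by simp [hni]) rfl hg h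
  have eu : ∀ (f : Bool → ℝ) x, Function.update f i x (!i) = f (!i) := fun f x => by simp [hni]
  -- the multiplicity statement
  have main : ∀ f ∈ Set.Icc lo hi,
      mult ql₁ qh₁ f + mult ql₂ qh₂ f ≤ 4 ∧
      (ZZ μ κ (N₁ + N₂) lo hi i f → mult ql₁ qh₁ f + mult ql₂ qh₂ f ≤ 2) ∧
      (ZZ μ κ (N₁ + N₂) lo hi (!i) f → mult ql₁ qh₁ f + mult ql₂ qh₂ f ≤ 2) ∧
      (ZZ μ κ (N₁ + N₂) lo hi i f → ZZ μ κ (N₁ + N₂) lo hi (!i) f →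
        mult ql₁ qh₁ f + mult ql₂ qh₂ f ≤ 1) := by
    intro f hf
    rcases lt_or_ge (f i) v with hfv | hfv
    · have z2 : mult ql₂ qh₂ f = 0 := mult_zero fun l hl => by
        have := hl.1 i
        have := G₂.envl l i
        linarith
      have hfm : f ∈ Set.Icc lo (Function.update hi i c) := by
        have := pm₁ f hf
        rwa [min_eq_left (by linarith), Function.update_eq_self] at this
      have zi : ZZ μ κ (N₁ + N₂) lo hi i f → ZZ μ κ N₁ lo (Function.update hi i c) i f := by
        rintro (h | h)
        · exact Or.inl (zoneL f h).2
        · have := (zoneH f h).1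
          linarith
      rw [z2, add_zero]
      exact ⟨G₁.m4 f hfm, fun h => G₁.m2 f hfm i (zi h), fun h => G₁.m2 f hfm _ (tr₁ f f rfl h),
        fun h h' => G₁.m1 f hfm i (zi h) (tr₁ f f rfl h')⟩
    rcases lt_or_ge u (f i) with hfu | hfu
    · have z1 : mult ql₁ qh₁ f = 0 := mult_zero fun l hl => by
        have := hl.2 i
        have := G₁.envh l i
        linarith
      have hfm : f ∈ Set.Icc (Function.update lo i c) hi := by
        have := pm₂ f hf
        rwa [max_eq_left (by linarith), Function.update_eq_self] at this
      have zi : ZZ μ κ (N₁ + N₂) lo hi i f → ZZ μ κ N₂ (Function.update lo i c) hi i f := by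
        rintro (h | h)
        · have := (zoneL f h).1
          linarith
        · exact Or.inr (zoneH f h).2
      rw [z1, zero_add]
      exact ⟨G₂.m4 f hfm, fun h => G₂.m2 f hfm i (zi h), fun h => G₂.m2 f hfm _ (tr₂ f f rfl h),
        fun h h' => G₂.m1 f hfm i (zi h) (tr₂ f f rfl h')⟩
    have hno : ¬ ZZ μ κ (N₁ + N₂) lo hi i f := by
      rintro (h | h)
      · have := (zoneL f h).1
        linarith
      · have := (zoneH f h).1
        linarith
    have y1 := hz₁ (min (f i) c) (le_min hfv hvc) (min_le_right _ _)
      (Function.update f i (min (f i) c)) (by simp)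
    have y2 := hz₂ (max (f i) c) (le_max_right _ _) (max_le hfu hcu)
      (Function.update f i (max (f i) c)) (by simp)
    have a1 := G₁.m2 _ (pm₁ f hf) i y1
    have a2 := G₂.m2 _ (pm₂ f hf) i y2
    have b1 := proj₁ f
    have b2 := proj₂ f
    refine ⟨by omega, fun h => absurd h hno, fun h => ?_, fun h => absurd h hno⟩
    have c1 := G₁.m1 _ (pm₁ f hf) i y1 (tr₁ f _ (eu _ _) h)
    have c2 := G₂.m1 _ (pm₂ f hf) i y2 (tr₂ f _ (eu _ _) h)
    omega
  refine ⟨ι₁ ⊕ ι₂, inferInstance, Sum.elim ql₁ ql₂, Sum.elim qh₁ qh₂, Sum.elim ν₁ ν₂, ?_⟩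
  exact
  { card := by simp [G₁.card, G₂.card]
    envl := by
      rintro (l | l) j
      · exact (hE1l j).trans (G₁.envl l j)
      · exact (hE2l j).trans (G₂.envl l j)
    envh := by
      rintro (l | l) j
      · exact (G₁.envh l j).trans (hE1h j)
      · exact (G₂.envh l j).trans (hE2h j)
    le := by
      rintro (l | l) j
      · exact G₁.le l j
      · exact G₂.le l j
    ratio := by
      rintro (l | l) j
      · exact G₁.ratio l j
      · exact G₂.ratio l j
    meetl := by
      rintro (l | l) j
      · exact (G₁.meetl l j).trans (uph j)
      · exact G₂.meetl l j
    meeth := by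
      rintro (l | l) j
      · exact G₁.meeth l j
      · exact (upl j).trans (G₂.meeth l j)
    cover := by
      intro f hf
      rcases le_total (f i) c with h | h
      · have := pm₁ f hf
        rw [min_eq_left h, Function.update_eq_self] at this
        obtain ⟨l, hl⟩ := G₁.cover f this
        exact ⟨Sum.inl l, hl⟩
      · have := pm₂ f hf
        rw [max_eq_left h, Function.update_eq_self] at this
        obtain ⟨l, hl⟩ := G₂.cover f this
        exact ⟨Sum.inr l, hl⟩
    sum := by
      rw [Fintype.sum_sum_type, bx_split μ hnull lo hi i c hlc hch, ← G₁.sum, ← G₂.sum]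
      rfl
    supp := by
      rintro (l | l)
      · exact G₁.supp l
      · exact G₂.supp l
    mass := by
      rintro (l | l)
      · exact G₁.mass l
      · exact G₂.mass l
    m4 := fun f hf => by
      rw [mult_sum]; exact (main f hf).1
    m2 := fun f hf j hj => by
      rw [mult_sum]
      by_cases h : j = i
      · subst h; exact (main f hf).2.1 hj
      · have : j = !i := by cases i <;> cases j <;> simp_all
        subst this
        exact (main f hf).2.2.1 hj
    m1 := fun f hf j hj hj' => by
      rw [mult_sum]
      by_cases h : j = i
      · subst h; exact (main f hf).2.2.2 hj hj'
      · have : j = !i := by cases i <;> cases j <;> simp_all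
        subst this
        rw [Bool.not_not] at hj'
        exact (main f hf).2.2.2 hj' hj }

theorem face_null (μ : Measure ℂ) (hnull : ∀ i t, μ {z | co z i = t} = 0) (lo hi : Bool → ℝ)
    (i : Bool) (h : hi i ≤ lo i) : μ.real (bx lo hi) = 0 := by
  have : μ (bx lo hi) = 0 := by
    refine measure_mono_null ?_ (hnull i (lo i))
    intro z hz
    exact le_antisymm ((hz.2 i).trans h) (hz.1 i)
  simp [Measure.real, this]

theorem step (μ : Measure ℂ) [IsFiniteMeasure μ] (κ : ℝ) (hκ : 0 < κ)
    (hnull : ∀ i t, μ {z | co z i = t} = 0) (N₁ N₂ : ℕ) (hN₁ : 1 ≤ N₁) (hN₂ : 1 ≤ N₂)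
    (lo hi elo ehi : Bool → ℝ) (hlh : ∀ i, lo i < hi i)
    (hel : ∀ i, elo i ≤ lo i) (heh : ∀ i, hi i ≤ ehi i)
    (hr : ∀ i, ehi i - elo i ≤ 3 * (ehi (!i) - elo (!i)))
    (i : Bool) (hw : hi (!i) - lo (!i) ≤ hi i - lo i) (c : ℝ)
    (hlc : lo i ≤ c) (hch : c ≤ hi i)
    (hm₁ : μ.real (bx lo (Function.update hi i c)) = N₁ * κ)
    (hm₂ : μ.real (bx (Function.update lo i c) hi) = N₂ * κ)
    (hc₁ : c ≤ hi i - (hi (!i) - lo (!i)) / 3 ∨ N₁ = 1)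
    (hc₂ : lo i + (hi (!i) - lo (!i)) / 3 ≤ c ∨ N₂ = 1 ∨
      μ.real (bx (Function.update lo i c)
        (Function.update hi i (hi i - (hi (!i) - lo (!i)) / 3))) < κ)
    (IH : ∀ N, 1 ≤ N → N < N₁ + N₂ → ∀ lo hi elo ehi : Bool → ℝ, (∀ i, lo i < hi i) →
      (∀ i, elo i ≤ lo i) → (∀ i, hi i ≤ ehi i) →
      (∀ i, ehi i - elo i ≤ 3 * (ehi (!i) - elo (!i))) →
      μ.real (bx lo hi) = N * κ → Good μ κ N lo hi elo ehi) :
    Good μ κ (N₁ + N₂) lo hi elo ehi := by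
  have hni : (!i) ≠ i := by cases i <;> simp
  have hni' : i ≠ (!i) := hni.symm
  have cs : ∀ j, j = i ∨ j = !i := by intro j; cases i <;> cases j <;> simp
  have h1N : (1 : ℝ) ≤ N₁ := by exact_mod_cast hN₁
  have h2N : (1 : ℝ) ≤ N₂ := by exact_mod_cast hN₂
  have hlc' : lo i < c := by
    by_contra hcon
    have := face_null μ hnull lo (Function.update hi i c) i (by simpa using hcon)
    rw [hm₁] at this
    nlinarith
  have hch' : c < hi i := by
    by_contra hcon
    have := face_null μ hnull (Function.update lo i c) hi i (by simpa using hcon)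
    rw [hm₂] at this
    nlinarith
  obtain ⟨h, hh⟩ : ∃ h, h = hi (!i) - lo (!i) := ⟨_, rfl⟩
  rw [← hh] at hw hc₁ hc₂
  have hpos : 0 < h := by rw [hh]; linarith [hlh (!i)]
  have hri := hr i
  have hli := hel i
  have hhi := heh i
  have hlj := hel (!i)
  have hhj := heh (!i)
  obtain ⟨a₁, b₁, p1, p2, p3, p4, p5⟩ := mid_interval (ℓ := max h ((c - lo i) / 3)) hlj hhj
    (by rw [← hh]; exact le_max_left _ _) (max_le (by linarith) (by linarith))
  obtain ⟨a₂, b₂, q1, q2, q3, q4, q5⟩ := mid_interval (ℓ := max h ((hi i - c) / 3)) hlj hhj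
    (by rw [← hh]; exact le_max_left _ _) (max_le (by linarith) (by linarith))
  obtain ⟨u, hu⟩ : ∃ u, u = max c (lo i + h / 3) := ⟨_, rfl⟩
  obtain ⟨v, hv⟩ : ∃ v, v = min c (hi i - h / 3) := ⟨_, rfl⟩
  have u1 : c ≤ u := by rw [hu]; exact le_max_left _ _
  have u2 : lo i + h / 3 ≤ u := by rw [hu]; exact le_max_right _ _
  have u3 : u = c ∨ u = lo i + h / 3 := by rw [hu]; exact max_choice _ _
  have v1 : v ≤ c := by rw [hv]; exact min_le_left _ _
  have v2 : v ≤ hi i - h / 3 := by rw [hv]; exact min_le_right _ _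
  have v3 : v = c ∨ v = hi i - h / 3 := by rw [hv]; exact min_choice _ _
  have hm1 := le_max_left h ((c - lo i) / 3)
  have hm1' := le_max_right h ((c - lo i) / 3)
  have hm2 := le_max_left h ((hi i - c) / 3)
  have hm2' := le_max_right h ((hi i - c) / 3)
  have G₁ := IH N₁ hN₁ (by omega) lo (Function.update hi i c)
    (Function.update (fun _ => lo i) (!i) a₁) (Function.update (fun _ => u) (!i) b₁)
    (fun j => by
      rcases cs j with rfl | rfl
      · simpa using hlc'
      · simpa [hni] using hlh _)
    (fun j => by
      rcases cs j with rfl | rfl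
      · simp [hni']
      · simpa using p2)
    (fun j => by
      rcases cs j with rfl | rfl
      · simpa [hni'] using u1
      · simpa [hni] using p3)
    (fun j => by
      rcases cs j with rfl | rfl
      · simp only [Function.update_self, Function.update_of_ne hni', p5]
        rcases u3 with e | e <;> linarith
      · simp only [Function.update_self, Function.update_of_ne hni', p5, Bool.not_not]
        refine max_le ?_ ?_ <;> linarith)
    hm₁
  have G₂ := IH N₂ hN₂ (by omega) (Function.update lo i c) hi
    (Function.update (fun _ => v) (!i) a₂) (Function.update (fun _ => hi i) (!i) b₂)
    (fun j => by
      rcases cs j with rfl | rfl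
      · simpa using hch'
      · simpa [hni] using hlh _)
    (fun j => by
      rcases cs j with rfl | rfl
      · simpa [hni'] using v1
      · simpa [hni] using q2)
    (fun j => by
      rcases cs j with rfl | rfl
      · simp [hni']
      · simpa using q3)
    (fun j => by
      rcases cs j with rfl | rfl
      · simp only [Function.update_self, Function.update_of_ne hni', q5]
        rcases v3 with e | e <;> linarith
      · simp only [Function.update_self, Function.update_of_ne hni', q5, Bool.not_not]
        refine max_le ?_ ?_ <;> linarith)
    hm₂
  refine combine μ κ hκ hnull N₁ N₂ hN₁ hN₂ lo hi elo ehi _ _ _ _ i c u v hlc hch v1 u1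
    ?_ ?_ ?_ ?_ (by simp [hni']) (by simp [hni']) ?_ ?_ hm₁ hm₂ ?_ ?_ G₁ G₂
  · intro j
    rcases cs j with rfl | rfl
    · simpa [hni'] using hli
    · simpa using p1
  · intro j
    rcases cs j with rfl | rfl
    · simp only [Function.update_of_ne hni']
      rcases u3 with e | e <;> linarith
    · simpa using p4
  · intro j
    rcases cs j with rfl | rfl
    · simp only [Function.update_of_ne hni']
      rcases v3 with e | e <;> linarith
    · simpa using q1
  · intro j
    rcases cs j with rfl | rfl
    · simpa [hni'] using hhi
    · simpa using q4
  · rcases v3 with e | e <;> linarith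
  · rcases u3 with e | e <;> linarith
  · intro x hvx hxc f hf
    right
    rcases hc₁ with h' | h'
    · have : v = c := by rw [hv]; exact min_eq_left h'
      refine ⟨0, le_rfl, Or.inl ?_, ?_⟩
      · rw [face_null μ hnull _ _ i (by simp)]
        exact hκ
      · simp only [Function.update_self, hf]; linarith
    · refine ⟨3 * (c - x), by linarith, Or.inr h', ?_⟩
      simp only [Function.update_self, hf]; linarith
  · intro x hcx hxu f hf
    left
    by_cases h0 : lo i + h / 3 ≤ c
    · have : u = c := by rw [hu]; exact max_eq_left h0
      refine ⟨0, le_rfl, Or.inl ?_, ?_⟩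
      · rw [face_null μ hnull _ _ i (by simp)]
        exact hκ
      · simp only [Function.update_self, hf]; linarith
    · rcases hc₂.resolve_left h0 with h' | h'
      · refine ⟨3 * (x - c), by linarith, Or.inr h', ?_⟩
        simp only [Function.update_self, hf]; linarith
      · refine ⟨hi i - h / 3 - c, by linarith, Or.inl ?_, ?_⟩
        · simpa using h'
        · simp only [Function.update_self, hf]
          rcases u3 with e | e <;> linarith

theorem exists_good (μ : Measure ℂ) [IsFiniteMeasure μ] (κ : ℝ) (hκ : 0 < κ)
    (hnull : ∀ i t, μ {z | co z i = t} = 0) (N : ℕ) : 1 ≤ N →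
    ∀ lo hi elo ehi : Bool → ℝ, (∀ i, lo i < hi i) →
      (∀ i, elo i ≤ lo i) → (∀ i, hi i ≤ ehi i) →
      (∀ i, ehi i - elo i ≤ 3 * (ehi (!i) - elo (!i))) →
      μ.real (bx lo hi) = N * κ → Good μ κ N lo hi elo ehi := by
  induction N using Nat.strong_induction_on with
  | _ N IH =>
  intro hN lo hi elo ehi hlh hel heh hr hm
  rcases Nat.eq_or_lt_of_le hN with rfl | hN2
  · exact good_one μ κ lo hi elo ehi hlh hel heh hr (by simpa using hm)
  obtain ⟨i, hw⟩ : ∃ i, hi (!i) - lo (!i) ≤ hi i - lo i := by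
    rcases le_total (hi true - lo true) (hi false - lo false) with h | h
    · exact ⟨false, h⟩
    · exact ⟨true, h⟩
  have hlhi := hlh i
  have hlhj := hlh (!i)
  obtain ⟨h, hh⟩ : ∃ h, h = hi (!i) - lo (!i) := ⟨_, rfl⟩
  obtain ⟨m, hmdef⟩ : ∃ m : ℝ → ℝ, m = fun c => μ.real (bx lo (Function.update hi i c)) :=
    ⟨_, rfl⟩
  have mc : Continuous m := by rw [hmdef]; exact cont_mass μ hnull lo hi i
  have m0 : m (lo i) = 0 := by rw [hmdef]; exact face_null μ hnull _ _ i (by simp)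
  have mN : m (hi i) = N * κ := by rw [hmdef]; simpa using hm
  have madd : ∀ c d, lo i ≤ c → c ≤ d →
      m d = m c + μ.real (bx (Function.update lo i c) (Function.update hi i d)) := by
    intro c d h1 h2
    have := bx_split μ hnull lo (Function.update hi i d) i c h1 (by simpa using h2)
    have := congrArg (fun ν : Measure ℂ => ν.real Set.univ) this
    simp only [Function.update_idem] at this
    rw [measureReal_add_apply] at this
    simpa [hmdef, measureReal_restrict_apply_univ] using this
  have mmono : ∀ c d, lo i ≤ c → c ≤ d → m c ≤ m d := fun c d h1 h2 => by
    rw [madd c d h1 h2]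
    linarith [measureReal_nonneg (μ := μ)
      (s := bx (Function.update lo i c) (Function.update hi i d))]
  have finish : ∀ n : ℕ, 1 ≤ n → n < N → ∀ c, lo i ≤ c → c ≤ hi i → m c = n * κ →
      (c ≤ hi i - h / 3 ∨ n = 1) →
      (lo i + h / 3 ≤ c ∨ N - n = 1 ∨ (c ≤ hi i - h / 3 ∧ m (hi i - h / 3) < (n + 1) * κ)) →
      Good μ κ N lo hi elo ehi := by
    intro n hn1 hnN c hc1 hc2 hmc k1 k2
    have eN : n + (N - n) = N := by omega
    have eN' : ((N - n : ℕ) : ℝ) = N - n := by push_cast [hnN.le]; ring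
    have hm2 : μ.real (bx (Function.update lo i c) hi) = (N - n : ℕ) * κ := by
      have := madd c (hi i) hc1 hc2
      rw [mN, hmc, Function.update_eq_self] at this
      rw [eN']
      linarith
    have := step μ κ hκ hnull n (N - n) hn1 (by omega) lo hi elo ehi hlh hel heh hr i hw c hc1 hc2
      (by rw [← hmc, hmdef]) hm2 (by rw [← hh]; exact k1)
      (by
        rw [← hh]
        rcases k2 with k | k | ⟨k, k'⟩
        · exact Or.inl k
        · exact Or.inr (Or.inl k)
        · refine Or.inr (Or.inr ?_)
          have := madd c (hi i - h / 3) hc1 k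
          linarith)
      (fun N' h1 h2 => IH N' (by omega) h1)
    rwa [eN] at this
  have ivt : ∀ a b, lo i ≤ a → a ≤ b → ∀ y, m a ≤ y → y ≤ m b → ∃ c, a ≤ c ∧ c ≤ b ∧ m c = y := by
    intro a b _ hab y h1 h2
    obtain ⟨c, hc, e⟩ := intermediate_value_Icc hab mc.continuousOn ⟨h1, h2⟩
    exact ⟨c, hc.1, hc.2, e⟩
  have hpos : 0 < h := by rw [hh]; linarith
  have hA1 : lo i ≤ lo i + h / 3 := by linarith
  have hAB : lo i + h / 3 ≤ hi i - h / 3 := by linarith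
  have hB1 : hi i - h / 3 ≤ hi i := by linarith
  have hN2' : (2 : ℝ) ≤ N := by exact_mod_cast hN2
  rcases lt_or_ge (m (lo i + h / 3)) κ with hA | hA
  · obtain ⟨c, c1, c2, c3⟩ := ivt (lo i + h / 3) (hi i) hA1 (by linarith) κ hA.le
      (by rw [mN]; nlinarith)
    exact finish 1 le_rfl (by omega) c (by linarith) c2 (by simpa using c3) (Or.inr rfl)
      (Or.inl c1)
  · obtain ⟨n, hn1, hnN, hnA, hor⟩ : ∃ n : ℕ, 1 ≤ n ∧ n < N ∧ n * κ ≤ m (lo i + h / 3) ∧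
        (N - n = 1 ∨ m (lo i + h / 3) < (n + 1) * κ) := by
      have f1 : (⌊m (lo i + h / 3) / κ⌋₊ : ℝ) ≤ m (lo i + h / 3) / κ :=
        Nat.floor_le (div_nonneg (by linarith) hκ.le)
      have f2 := Nat.lt_floor_add_one (m (lo i + h / 3) / κ)
      have f3 : 1 ≤ ⌊m (lo i + h / 3) / κ⌋₊ := by
        rw [Nat.one_le_floor_iff, le_div_iff₀ hκ]; linarith
      rw [le_div_iff₀ hκ] at f1
      rw [div_lt_iff₀ hκ] at f2
      rcases lt_or_ge ⌊m (lo i + h / 3) / κ⌋₊ N with hlt | hge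
      · exact ⟨_, f3, hlt, f1, Or.inr f2⟩
      · refine ⟨N - 1, by omega, by omega, ?_, Or.inl (by omega)⟩
        refine le_trans ?_ f1
        have : ((N - 1 : ℕ) : ℝ) ≤ (⌊m (lo i + h / 3) / κ⌋₊ : ℝ) := by
          exact_mod_cast (by omega : N - 1 ≤ ⌊m (lo i + h / 3) / κ⌋₊)
        exact mul_le_mul_of_nonneg_right this hκ.le
    by_cases hlast : N - n = 1
    · obtain ⟨c, c1, c2, c3⟩ := ivt (lo i) (lo i + h / 3) le_rfl hA1 (n * κ)
        (by rw [m0]; positivity) hnA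
      exact finish n hn1 hnN c c1 (by linarith) c3 (Or.inl (by linarith)) (Or.inr (Or.inl hlast))
    have hor := hor.resolve_left hlast
    rcases lt_or_ge (m (hi i - h / 3)) ((n + 1) * κ) with hB | hB
    · obtain ⟨c, c1, c2, c3⟩ := ivt (lo i) (lo i + h / 3) le_rfl hA1 (n * κ)
        (by rw [m0]; positivity) hnA
      exact finish n hn1 hnN c c1 (by linarith) c3 (Or.inl (by linarith))
        (Or.inr (Or.inr ⟨by linarith, hB⟩))
    · obtain ⟨c, c1, c2, c3⟩ := ivt (lo i + h / 3) (hi i - h / 3) hA1 hAB ((n + 1) * κ)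
        hor.le hB
      exact finish (n + 1) (by omega) (by omega) c (by linarith) (by linarith)
        (by push_cast; exact c3) (Or.inl c2) (Or.inl c1)

theorem volume_line (i : Bool) (t : ℝ) : (volume : Measure ℂ) {z | co z i = t} = 0 := by
  have h := Complex.volume_preserving_equiv_real_prod
  cases i
  · have e : {z : ℂ | co z false = t} =
        Complex.measurableEquivRealProd ⁻¹' (({t} : Set ℝ) ×ˢ (Set.univ : Set ℝ)) := by
      ext z; simp [co, Complex.measurableEquivRealProd_apply]
    rw [e, h.measure_preimage_equiv, Measure.volume_eq_prod, Measure.prod_prod]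
    simp
  · have e : {z : ℂ | co z true = t} =
        Complex.measurableEquivRealProd ⁻¹' ((Set.univ : Set ℝ) ×ˢ ({t} : Set ℝ)) := by
      ext z; simp [co, Complex.measurableEquivRealProd_apply]
    rw [e, h.measure_preimage_equiv, Measure.volume_eq_prod, Measure.prod_prod]
    simp

theorem closure_QR (R : ℝ) (hR : 0 < R) :
    closure (QR R) = bx (fun _ => -R) (fun _ => R) := by
  have e : QR R = Set.Ioo (-R) R ×ℂ Set.Ioo (-R) R := by
    ext z; simp [QR, Complex.mem_reProdIm, abs_lt]
  rw [e, Complex.closure_reProdIm, closure_Ioo (by linarith)]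
  ext z
  simp only [Complex.mem_reProdIm, bx, co, Set.mem_preimage, Set.mem_Icc, Pi.le_def, Bool.forall_bool]
  simp
  tauto

theorem bx_eq (lo hi : Bool → ℝ) :
    bx lo hi = {z : ℂ | z.re ∈ Set.Icc (lo false) (hi false) ∧
      z.im ∈ Set.Icc (lo true) (hi true)} := by
  ext z
  simp only [bx, co, Set.mem_preimage, Set.mem_Icc, Pi.le_def, Bool.forall_bool, Set.mem_setOf_eq]
  simp
  tauto

theorem statement10 (R : ℝ) (hR : 0 < R) (M k : ℕ) (hM : 2 ≤ M) (hk : 1 ≤ k)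
    (a : ℂ → ℝ) (ha : ContDiff ℝ (⊤ : ℕ∞) a) (ha0 : ∀ z, 0 ≤ a z)
    (μhat : Measure ℂ)
    (hμhat : μhat =
      ((volume : Measure ℂ).withDensity (fun z => ENNReal.ofReal (a z))).restrict (QR R))
    (hmass : μhat Set.univ = ((M : ENNReal) - 1) / (M : ENNReal))
    (L : ℕ) (hL : L = k * (M - 1)) :
    ∃ (Qs : Fin L → Set ℂ) (μs : Fin L → Measure ℂ),
      (∀ l, Qs l ⊆ closure (QR R)) ∧
      (∀ l, ∃ x₁ x₂ y₁ y₂ : ℝ, x₁ ≤ x₂ ∧ y₁ ≤ y₂ ∧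
        Qs l = {z : ℂ | z.re ∈ Set.Icc x₁ x₂ ∧ z.im ∈ Set.Icc y₁ y₂} ∧
        max (x₂ - x₁) (y₂ - y₁) ≤ 3 * min (x₂ - x₁) (y₂ - y₁)) ∧
      QR R ⊆ (⋃ l, Qs l) ∧
      (∀ z : ℂ, ({l : Fin L | z ∈ Qs l} : Set (Fin L)).ncard ≤ 4) ∧
      μhat = ∑ l, μs l ∧
      (∀ l, μs l (Qs l)ᶜ = 0) ∧
      (∀ l, μs l (Qs l) = ((k * M : ℕ) : ENNReal)⁻¹) := by
  have hsub : QR R ⊆ bx (fun _ => -R) (fun _ => R) := by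
    rw [← closure_QR R hR]; exact subset_closure
  have hMr : (2 : ℝ) ≤ M := by exact_mod_cast hM
  have hkr : (1 : ℝ) ≤ k := by exact_mod_cast hk
  have hmass' : μhat Set.univ = ENNReal.ofReal (((M : ℝ) - 1) / M) := by
    rw [hmass, ENNReal.ofReal_div_of_pos (by linarith), ENNReal.ofReal_sub _ (by norm_num)]
    simp
  have hfin : IsFiniteMeasure μhat := ⟨by rw [hmass']; exact ENNReal.ofReal_lt_top⟩
  have hac : μhat ≪ volume := by
    rw [hμhat]
    exact Measure.restrict_le_self.absolutelyContinuous.trans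
      (withDensity_absolutelyContinuous _ _)
  have hnull : ∀ i t, μhat {z | co z i = t} = 0 := fun i t => hac (volume_line i t)
  have hrestr : μhat.restrict (bx (fun _ => -R) (fun _ => R)) = μhat := by
    rw [hμhat, Measure.restrict_restrict (measurableSet_bx _ _), Set.inter_eq_right.2 hsub]
  have hL1 : 1 ≤ L := by
    rw [hL]
    exact Nat.mul_pos hk (by omega)
  have hκ : (0 : ℝ) < ((k : ℝ) * M)⁻¹ := by positivity
  have hreal : μhat.real (bx (fun _ => -R) (fun _ => R)) = L * ((k : ℝ) * M)⁻¹ := by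
    rw [← measureReal_restrict_apply_univ, hrestr, Measure.real, hmass',
      ENNReal.toReal_ofReal (div_nonneg (by linarith) (by linarith)), hL]
    push_cast [show 1 ≤ M by omega]
    field_simp
  obtain ⟨ι, _, ql, qh, ν, G⟩ := exists_good μhat ((k : ℝ) * M)⁻¹ hκ hnull L hL1
    (fun _ => -R) (fun _ => R) (fun _ => -R) (fun _ => R) (fun _ => by linarith)
    (fun _ => le_rfl) (fun _ => le_rfl) (fun _ => by linarith) hreal
  obtain ⟨e⟩ : Nonempty (Fin L ≃ ι) := ⟨(Fintype.equivFinOfCardEq G.card).symm⟩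
  have hQsub : ∀ l, bx (ql l) (qh l) ⊆ bx (fun _ => -R) (fun _ => R) := fun l =>
    bx_mono (G.envl l) (G.envh l)
  refine ⟨fun l => bx (ql (e l)) (qh (e l)), fun l => ν (e l), ?_, ?_, ?_, ?_, ?_, ?_, ?_⟩
  · intro l
    rw [closure_QR R hR]
    exact hQsub _
  · intro l
    refine ⟨_, _, _, _, G.le (e l) false, G.le (e l) true, bx_eq _ _, ?_⟩
    have r1 := G.ratio (e l) false
    have r2 := G.ratio (e l) true
    have l1 := G.le (e l) false
    have l2 := G.le (e l) true
    simp only [Bool.not_false, Bool.not_true] at r1 r2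
    rw [mul_min_of_nonneg _ _ (by norm_num : (0 : ℝ) ≤ 3)]
    refine max_le (le_min ?_ ?_) (le_min ?_ ?_) <;> linarith
  · intro z hz
    obtain ⟨l, hl⟩ := G.cover (co z) (hsub hz)
    refine Set.mem_iUnion.2 ⟨e.symm l, ?_⟩
    simpa [bx] using hl
  · intro z
    by_cases hz : z ∈ bx (fun _ => -R) (fun _ => R)
    · have h4 := G.m4 (co z) hz
      refine le_trans (le_of_eq ?_) h4
      classical
      unfold mult
      rw [← e.sum_comp, Finset.sum_ite, Set.ncard_eq_toFinset_card']
      simp [bx]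
    · have : ({l : Fin L | z ∈ bx (ql (e l)) (qh (e l))} : Set (Fin L)) = ∅ := by
        ext l
        simp only [Set.mem_setOf_eq, Set.mem_empty_iff_false, iff_false]
        exact fun h => hz (hQsub _ h)
      rw [this]
      simp
  · rw [e.sum_comp (fun l => ν l), G.sum, hrestr]
  · intro l
    exact G.supp _
  · intro l
    have h1 := measure_add_measure_compl (μ := ν (e l)) (measurableSet_bx (ql (e l)) (qh (e l)))
    rw [G.supp, add_zero, G.mass] at h1
    rw [h1, ENNReal.ofReal_inv_of_pos (by positivity)]
    congr 1
    rw [← Nat.cast_mul, ENNReal.ofReal_natCast]
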